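/- Let M = (π₀, K, g) satisfy Assumption A2 and let {α_t} be parametric nudging transformations. Then for every finite t ∈ ℕ and every ε > 0 there exists a sequence of nudging parameters γ_1(ε),…,γ_t(ε) > 0 such that the alternative nudged model M̄^α built with these parameters satisfies: (i) Δ_{g_i}(γ_i) ≥ ‖g_i‖_∞ ‖ξ_i − ξ̄_i^α‖_TV for i = 1,…,t, and (ii) ‖ξ_{t+1} − ξ̄_{t+1}^α‖_TV ≤ ε. -/

import Mathlib

open MeasureTheory ENNReal

namespace Nudging

variable {X : Type*} [MeasurableSpace X]

/-- Total variation norm `‖μ - ν‖_TV = |sup_F (μ-ν)(F) - inf_F (μ-ν)(F)|` of the difference of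
two (finite) measures. -/
noncomputable def tvDist (μ ν : Measure X) : ℝ :=
  ((⨆ (F : Set X) (_ : MeasurableSet F), (μ F - ν F)) +
   (⨆ (F : Set X) (_ : MeasurableSet F), (ν F - μ F))).toReal

/-- Supremum norm of a real-valued function. -/
noncomputable def supNorm {α : Type*} (f : α → ℝ) : ℝ := ⨆ x, |f x|

/-- The (normalised) filter measures `π_t` of a state-space model `(π0, K, g)`:
`π_0 = π0` and `π_t(f) = ξ_t(f g_t)/ξ_t(g_t)` where `ξ_t = K_t π_{t-1}`. -/
noncomputable def filt (π0 : Measure X) (K : ℕ → X → Measure X) (g : ℕ → X → ℝ) :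
    ℕ → Measure X
  | 0 => π0
  | t + 1 =>
      let ξ : Measure X := (filt π0 K g t).bind (K (t + 1))
      let ν : Measure X := ξ.withDensity fun x => ENNReal.ofReal (g (t + 1) x)
      (ν Set.univ)⁻¹ • ν

/-- The one-step-ahead predictive measure `ξ_t = K_t π_{t-1}` (for `t ≥ 1`). -/
noncomputable def pred (π0 : Measure X) (K : ℕ → X → Measure X) (g : ℕ → X → ℝ)
    (t : ℕ) : Measure X :=
  (filt π0 K g (t - 1)).bind (K t)

/-- The Bayesian evidence (marginal likelihood) `p_T(y_{1:T}|M) = ∏_{t=1}^T ξ_t(g_t)`. -/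
noncomputable def evidence (π0 : Measure X) (K : ℕ → X → Measure X) (g : ℕ → X → ℝ)
    (T : ℕ) : ℝ :=
  ∏ t ∈ Finset.Icc 1 T, ∫ x, g t x ∂(pred π0 K g t)

/-- The nudged kernel `K_t^α(x,·)`: the pushforward of `K_t(x,·)` under the map `a t`. -/
noncomputable def nudged (K : ℕ → X → Measure X) (a : ℕ → X → X) : ℕ → X → Measure X :=
  fun t x => (K t x).map (a t)

/-- The alternative nudged kernel `K̄_t^α(x,·) := K_t(α_{t-1}(x), ·)`. -/
noncomputable def altKernel (K : ℕ → X → Measure X) (a : ℕ → X → X) : ℕ → X → Measure X :=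
  fun t x => K t (a (t - 1) x)

/-- The modified likelihoods `g_t^α := g_t ∘ α_t` of the alternative nudged model. -/
def altG (g : ℕ → X → ℝ) (a : ℕ → X → X) : ℕ → X → ℝ := fun t x => g t (a t x)

/-- Dobrushin (induced) norm of a Markov kernel:
`‖K‖ = sup_{x,x'} ‖K(x,·) - K(x',·)‖_TV`. -/
noncomputable def dobNorm (K : X → Measure X) : ℝ :=
  ⨆ p : X × X, tvDist (K p.1) (K p.2)


/-- The nudging maps obtained from a parametric family `α` and a sequence of nudging
parameters `γseq` (with `α₀` the identity). -/
noncomputable def aOf {X : Type*} (α : ℕ → X → ℝ → X) (γseq : ℕ → ℝ) : ℕ → X → X :=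
  fun t x => if t = 0 then x else α t x (γseq t)

section TotalVariation

variable {μ ν : Measure X}

lemma iSup_measure_sub_le {r : ℝ≥0∞} (h : ∀ F, MeasurableSet F → μ F ≤ ν F + r) :
    (⨆ (F : Set X) (_ : MeasurableSet F), (μ F - ν F)) ≤ r :=
  iSup₂_le fun F hF => tsub_le_iff_left.2 (h F hF)

lemma measure_le_add_ofReal [IsFiniteMeasure μ] [IsFiniteMeasure ν] {F : Set X} {r : ℝ}
    (hr : 0 ≤ r) (h : |μ.real F - ν.real F| ≤ r) : μ F ≤ ν F + ENNReal.ofReal r := by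
  rw [← ofReal_measureReal (μ := μ), ← ofReal_measureReal (μ := ν),
    ← ENNReal.ofReal_add measureReal_nonneg hr]
  exact ENNReal.ofReal_le_ofReal (by linarith [(abs_le.1 h).2])

lemma tvDist_le [IsFiniteMeasure μ] [IsFiniteMeasure ν] {r : ℝ} (hr : 0 ≤ r)
    (h : ∀ F, MeasurableSet F → |μ.real F - ν.real F| ≤ r) : tvDist μ ν ≤ 2 * r := by
  refine ENNReal.toReal_le_of_le_ofReal (by positivity) ?_
  rw [two_mul, ENNReal.ofReal_add hr hr]
  refine add_le_add (iSup_measure_sub_le fun F hF => measure_le_add_ofReal hr (h F hF))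
    (iSup_measure_sub_le fun F hF => measure_le_add_ofReal hr ?_)
  rw [abs_sub_comm]
  exact h F hF

lemma tvDist_nonneg : 0 ≤ tvDist μ ν := ENNReal.toReal_nonneg

lemma measureReal_sub_le_tvDist [IsProbabilityMeasure μ] [IsProbabilityMeasure ν] {F : Set X}
    (hF : MeasurableSet F) : |μ.real F - ν.real F| ≤ tvDist μ ν := by
  have bound {ρ σ : Measure X} [IsProbabilityMeasure ρ] :
      (⨆ (F : Set X) (_ : MeasurableSet F), (ρ F - σ F)) ≤ 1 :=
    iSup_measure_sub_le fun F _ => prob_le_one.trans le_add_self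
  have finite : (⨆ (F : Set X) (_ : MeasurableSet F), (μ F - ν F)) +
      (⨆ (F : Set X) (_ : MeasurableSet F), (ν F - μ F)) ≠ ∞ :=
    ENNReal.add_ne_top.2 ⟨(bound.trans_lt one_lt_top).ne, (bound.trans_lt one_lt_top).ne⟩
  have le_μν : μ F - ν F ≤ _ :=
    (le_iSup₂ (f := fun F (_ : MeasurableSet F) => μ F - ν F) F hF).trans
    (le_self_add (b := ⨆ (F : Set X) (_ : MeasurableSet F), (ν F - μ F)))
  have le_νμ : ν F - μ F ≤ _ :=
    (le_iSup₂ (f := fun F (_ : MeasurableSet F) => ν F - μ F) F hF).trans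
    (le_add_self (b := ⨆ (F : Set X) (_ : MeasurableSet F), (μ F - ν F)))
  have toReal_bound {ρ σ : Measure X} [IsProbabilityMeasure ρ] [IsProbabilityMeasure σ]
      (h : ρ F - σ F ≤ (⨆ (F : Set X) (_ : MeasurableSet F), (μ F - ν F)) +
        (⨆ (F : Set X) (_ : MeasurableSet F), (ν F - μ F))) :
      ρ.real F - σ.real F ≤ tvDist μ ν :=
    (ENNReal.le_toReal_sub (measure_ne_top σ F)).trans (ENNReal.toReal_mono finite h)
  exact abs_sub_le_iff.2 ⟨toReal_bound le_μν, toReal_bound le_νμ⟩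

lemma tvDist_self : tvDist μ μ = 0 := by simp [tvDist]

lemma integral_sub_le_mul_tvDist [IsProbabilityMeasure μ] [IsProbabilityMeasure ν] {f : X → ℝ}
    {C : ℝ} (hC : 0 ≤ C) (hf : Measurable f) (hf0 : ∀ x, 0 ≤ f x) (hfC : ∀ x, f x ≤ C) :
    |∫ x, f x ∂μ - ∫ x, f x ∂ν| ≤ C * tvDist μ ν := by
  have layers (ρ : Measure X) [IsProbabilityMeasure ρ] :
      ∫ x, f x ∂ρ = ∫ s in Set.Ioc 0 C, ρ.real {x | s ≤ f x} :=
    (Integrable.of_mem_Icc 0 C hf.aemeasurable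
      (.of_forall fun x => ⟨hf0 x, hfC x⟩)).integral_eq_integral_Ioc_meas_le
      (.of_forall hf0) (.of_forall hfC)
  have integrable (ρ : Measure X) [IsProbabilityMeasure ρ] :
      IntegrableOn (fun s => ρ.real {x | s ≤ f x}) (Set.Ioc 0 C) := by
    have anti : Antitone fun s => ρ.real {x | s ≤ f x} :=
      fun s s' h => measureReal_mono fun x (hx : s' ≤ f x) => h.trans hx
    exact Integrable.of_mem_Icc 0 1 anti.measurable.aemeasurable
      (.of_forall fun s => ⟨measureReal_nonneg, measureReal_le_one⟩)
  rw [layers μ, layers ν, ← integral_sub (integrable μ) (integrable ν), ← Real.norm_eq_abs]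
  refine (norm_setIntegral_le_of_norm_le_const (C := tvDist μ ν) (by simp) fun s _ =>
    measureReal_sub_le_tvDist (measurableSet_le measurable_const hf)).trans_eq ?_
  simp [hC, mul_comm]

end TotalVariation

section Update

/-- One step of the predictive recursion: reweight `ξ` by the likelihood `G`, normalise, and
propagate through the kernel `L`. -/
noncomputable def update (ξ : Measure X) (G : X → ℝ) (L : X → Measure X) : Measure X :=
  (((ξ.withDensity fun x => ENNReal.ofReal (G x)) Set.univ)⁻¹ •
    ξ.withDensity fun x => ENNReal.ofReal (G x)).bind L

lemma pred_add_two (π0 : Measure X) (K : ℕ → X → Measure X) (g : ℕ → X → ℝ) (t : ℕ) :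
    pred π0 K g (t + 2) = update (pred π0 K g (t + 1)) (g (t + 1)) (K (t + 2)) := rfl

variable {ξ : Measure X} {G : X → ℝ} {L : X → Measure X}

lemma update_real (hG : Measurable G) (hG0 : ∀ x, 0 ≤ G x)
    (hL : Measurable L) (hLprob : ∀ x, IsProbabilityMeasure (L x)) {F : Set X}
    (hF : MeasurableSet F) :
    (update ξ G L).real F = (∫ x, (L x).real F * G x ∂ξ) / ∫ x, G x ∂ξ := by
  have hLF : Measurable fun x => L x F := (Measure.measurable_coe hF).comp hL
  have mass : ∫ x, G x ∂ξ = (∫⁻ x, ENNReal.ofReal (G x) ∂ξ).toReal :=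
    integral_eq_lintegral_of_nonneg_ae (.of_forall hG0) hG.aestronglyMeasurable
  have numerator : ∫ x, (L x).real F * G x ∂ξ =
      (∫⁻ x, ENNReal.ofReal (G x) * L x F ∂ξ).toReal := by
    rw [integral_eq_lintegral_of_nonneg_ae
      (.of_forall fun x => mul_nonneg measureReal_nonneg (hG0 x))
      (hLF.ennreal_toReal.mul hG).aestronglyMeasurable]
    congr 2 with x
    rw [mul_comm, ENNReal.ofReal_mul (hG0 x), ofReal_measureReal]
  rw [measureReal_def, update, Measure.bind_apply hF hL.aemeasurable, lintegral_smul_measure,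
    lintegral_withDensity_eq_lintegral_mul _ hG.ennreal_ofReal hLF,
    withDensity_apply _ MeasurableSet.univ, Measure.restrict_univ, smul_eq_mul,
    ENNReal.toReal_mul, ENNReal.toReal_inv, mass, numerator, div_eq_inv_mul]
  rfl

lemma isProbabilityMeasure_update (hG : Measurable G) (hG0 : ∀ x, 0 ≤ G x)
    (hL : Measurable L) (hLprob : ∀ x, IsProbabilityMeasure (L x)) (hpos : 0 < ∫ x, G x ∂ξ) :
    IsProbabilityMeasure (update ξ G L) := by
  refine ⟨(ENNReal.toReal_eq_one_iff _).1 ?_⟩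
  rw [← measureReal_def, update_real hG hG0 hL hLprob MeasurableSet.univ]
  simp [hpos.ne']

lemma update_eq_zero_of_integral_eq_zero [IsProbabilityMeasure ξ] (hG : Measurable G)
    (hG0 : ∀ x, 0 ≤ G x) {C : ℝ} (hGC : ∀ x, G x ≤ C) (hzero : ∫ x, G x ∂ξ = 0) :
    update ξ G L = 0 := by
  have integrable : Integrable G ξ :=
    Integrable.of_mem_Icc 0 C hG.aemeasurable (.of_forall fun x => ⟨hG0 x, hGC x⟩)
  have null : ξ.withDensity (fun x => ENNReal.ofReal (G x)) = 0 := by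
    rw [withDensity_eq_zero_iff hG.ennreal_ofReal.aemeasurable]
    filter_upwards [(integral_eq_zero_iff_of_nonneg hG0 integrable).1 hzero] with x hx
    simp [hx]
  rw [update, null]
  simp

end Update

lemma abs_div_sub_div_le {a b a' b' r : ℝ} (hb : 0 < b) (hb' : 0 < b')
    (ha' : 0 ≤ a') (hab' : a' ≤ b') (hnum : |a - a'| ≤ r) (hden : |b - b'| ≤ r) :
    |a / b - a' / b'| ≤ 2 * r / b := by
  have split : a / b - a' / b' = (a - a') / b + a' / b' * ((b' - b) / b) := by
    field_simp
    ring
  rw [split]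
  refine (abs_add_le _ _).trans ?_
  rw [abs_mul, abs_div, abs_div, abs_div, abs_of_pos hb, abs_of_pos hb', abs_of_nonneg ha',
    abs_sub_comm b' b]
  have first : |a - a'| / b ≤ r / b := by gcongr
  have second : a' / b' * (|b - b'| / b) ≤ 1 * (r / b) := by
    gcongr
    exact (div_le_one hb').2 hab'
  linarith [show 2 * r / b = r / b + r / b by ring]

section Perturbation

open Filter Topology

variable {E : Type*} [NormedAddCommGroup E] [MeasurableSpace E] [BorelSpace E]
  {ξ : Measure E} {G : E → ℝ} {C : ℝ} {L : E → Measure E} {β : E → ℝ → E}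

/-- The unnormalised updates of a fixed measure converge, uniformly over measurable sets, as the
nudging parameter vanishes. -/
lemma eventually_integral_nudged_sub_le [IsProbabilityMeasure ξ]
    (hG : Continuous G) (hG0 : ∀ x, 0 ≤ G x) (hGC : ∀ x, G x ≤ C)
    (hL : Measurable L) (hLprob : ∀ x, IsProbabilityMeasure (L x))
    (hLtv : ∀ x, ∀ ε > (0 : ℝ), ∃ δ > (0 : ℝ), ∀ x', ‖x - x'‖ ≤ δ → tvDist (L x) (L x') ≤ ε)
    (hβmeas : ∀ γ, Measurable fun x => β x γ)
    (hβlim : ∀ x, Tendsto (β x) (𝓝[>] 0) (𝓝 x)) {r : ℝ} (hr : 0 < r) :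
    ∀ᶠ γ in 𝓝[>] (0 : ℝ), ∀ F, MeasurableSet F →
      |∫ x, (L x).real F * G x ∂ξ - ∫ x, (L (β x γ)).real F * G (β x γ) ∂ξ| ≤ r := by
  have hφmeas {F : Set E} (hF : MeasurableSet F) : Measurable fun x => (L x).real F * G x :=
    ((Measure.measurable_coe hF).comp hL).ennreal_toReal.mul hG.measurable
  have hφ0 (F : Set E) (x : E) : 0 ≤ (L x).real F * G x :=
    mul_nonneg measureReal_nonneg (hG0 x)
  have hφC (F : Set E) (x : E) : (L x).real F * G x ≤ C :=
    (mul_le_of_le_one_left (hG0 x) measureReal_le_one).trans (hGC x)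
  have hφdiff {F : Set E} (hF : MeasurableSet F) (x y : E) :
      |(L x).real F * G x - (L y).real F * G y| ≤ C * tvDist (L x) (L y) + |G x - G y| := by
    have split : (L x).real F * G x - (L y).real F * G y =
        ((L x).real F - (L y).real F) * G x + (L y).real F * (G x - G y) := by ring
    rw [split]
    refine (abs_add_le _ _).trans (add_le_add ?_ ?_)
    · rw [abs_mul, abs_of_nonneg (hG0 x), mul_comm C]
      exact mul_le_mul (measureReal_sub_le_tvDist hF) (hGC x) (hG0 x) tvDist_nonneg
    · rw [abs_mul, abs_of_nonneg measureReal_nonneg]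
      exact mul_le_of_le_one_left (abs_nonneg _) measureReal_le_one
  have htv (x : E) : Tendsto (fun y => tvDist (L x) (L y)) (𝓝 x) (𝓝 0) := by
    rw [Metric.tendsto_nhds]
    intro η hη
    obtain ⟨δ, hδ, h⟩ := hLtv x (η / 2) (by positivity)
    filter_upwards [Metric.ball_mem_nhds x hδ] with y hy
    rw [Real.dist_0_eq_abs, abs_of_nonneg tvDist_nonneg]
    refine (h y ?_).trans_lt (half_lt_self hη)
    rw [← dist_eq_norm, dist_comm]
    exact hy.le
  have hlim (x : E) : Tendsto (fun γ => C * tvDist (L x) (L (β x γ)) + |G x - G (β x γ)|)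
      (𝓝[>] 0) (𝓝 0) := by
    have htv' := ((htv x).comp (hβlim x)).const_mul C
    have hG' := (tendsto_const_nhds (x := G x)).sub ((hG.tendsto x).comp (hβlim x)) |>.abs
    simpa using htv'.add hG'
  have hconv : Tendsto (fun p : ℝ × {F : Set E // MeasurableSet F} =>
      ∫ x, ((L x).real p.2 * G x - (L (β x p.1)).real p.2 * G (β x p.1)) ∂ξ)
      (𝓝[>] 0 ×ˢ 𝓟 Set.univ) (𝓝 (∫ _, (0 : ℝ) ∂ξ)) := by
    refine tendsto_integral_filter_of_dominated_convergence (fun _ => C) (.of_forall fun p =>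
      ((hφmeas p.2.2).sub ((hφmeas p.2.2).comp (hβmeas p.1))).aestronglyMeasurable)
      (.of_forall fun p => .of_forall fun x => ?_) (integrable_const _) (.of_forall fun x => ?_)
    · rw [Real.norm_eq_abs, abs_le]
      constructor <;> linarith [hφ0 p.2 x, hφ0 p.2 (β x p.1), hφC p.2 x, hφC p.2 (β x p.1)]
    · exact squeeze_zero_norm (fun p => hφdiff p.2.2 x (β x p.1)) ((hlim x).comp tendsto_fst)
  rw [integral_zero, Metric.tendsto_nhds] at hconv
  have huniform := eventually_prod_principal_iff.1 (hconv r hr)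
  filter_upwards [huniform] with γ hγ F hF
  have h := hγ ⟨F, hF⟩ (Set.mem_univ _)
  have integrable {φ : E → ℝ} (hφ : Measurable φ) (h0 : ∀ x, 0 ≤ φ x) (hC : ∀ x, φ x ≤ C) :
      Integrable φ ξ :=
    Integrable.of_mem_Icc 0 C hφ.aemeasurable (.of_forall fun x => ⟨h0 x, hC x⟩)
  have integrable_nudged : Integrable (fun x => (L (β x γ)).real F * G (β x γ)) ξ :=
    integrable ((hφmeas hF).comp (hβmeas γ)) (fun x => hφ0 F (β x γ)) (fun x => hφC F (β x γ))
  rw [integral_sub (integrable (hφmeas hF) (hφ0 F) (hφC F)) integrable_nudged,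
    Real.dist_0_eq_abs] at h
  exact h.le

/-- For small nudging parameters, nudging and perturbing the input measure slightly changes the
output of a predictive step by little in total variation. -/
lemma eventually_update_nudged_close [IsProbabilityMeasure ξ]
    (hG : Continuous G) (hG0 : ∀ x, 0 ≤ G x) (hGC : ∀ x, G x ≤ C) (hpos : 0 < ∫ x, G x ∂ξ)
    (hL : Measurable L) (hLprob : ∀ x, IsProbabilityMeasure (L x))
    (hLtv : ∀ x, ∀ ε > (0 : ℝ), ∃ δ > (0 : ℝ), ∀ x', ‖x - x'‖ ≤ δ → tvDist (L x) (L x') ≤ ε)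
    (hβmeas : ∀ γ, Measurable fun x => β x γ)
    (hβlim : ∀ x, Tendsto (β x) (𝓝[>] 0) (𝓝 x)) {ε : ℝ} (hε : 0 < ε) :
    ∃ η > (0 : ℝ), ∀ᶠ γ in 𝓝[>] (0 : ℝ), ∀ ξ' : Measure E, IsProbabilityMeasure ξ' →
      tvDist ξ ξ' ≤ η →
      IsProbabilityMeasure (update ξ' (fun x => G (β x γ)) fun x => L (β x γ)) ∧
      tvDist (update ξ G L) (update ξ' (fun x => G (β x γ)) fun x => L (β x γ)) ≤ ε := by
  set Z := ∫ x, G x ∂ξ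
  have hC : 0 ≤ C := (hG0 0).trans (hGC 0)
  obtain ⟨r, hr, hrZ, hrε⟩ : ∃ r > 0, r < Z ∧ 2 * (2 * r / Z) ≤ ε := by
    refine ⟨min (Z / 2) (ε * Z / 4), by positivity,
      (min_le_left _ _).trans_lt (half_lt_self hpos), ?_⟩
    calc 2 * (2 * min (Z / 2) (ε * Z / 4) / Z) ≤ 2 * (2 * (ε * Z / 4) / Z) := by
          gcongr
          exact min_le_right _ _
      _ = ε := by field_simp; ring
  refine ⟨r / (2 * (C + 1)), by positivity, ?_⟩
  filter_upwards [eventually_integral_nudged_sub_le (ξ := ξ) hG hG0 hGC hL hLprob hLtv hβmeas hβlim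
    (half_pos hr)] with γ hγ ξ' hξ' hclose
  have hG' : Measurable fun x => G (β x γ) := hG.measurable.comp (hβmeas γ)
  have hL' : Measurable fun x => L (β x γ) := hL.comp (hβmeas γ)
  have numerator_close (F : Set E) (hF : MeasurableSet F) :
      |∫ x, (L x).real F * G x ∂ξ - ∫ x, (L (β x γ)).real F * G (β x γ) ∂ξ'| ≤ r := by
    have h := integral_sub_le_mul_tvDist (μ := ξ) (ν := ξ')
      (f := fun x => (L (β x γ)).real F * G (β x γ)) hC
      (((Measure.measurable_coe hF).comp hL').ennreal_toReal.mul hG')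
      (fun x => mul_nonneg measureReal_nonneg (hG0 (β x γ)))
      (fun x => (mul_le_of_le_one_left (hG0 (β x γ)) measureReal_le_one).trans (hGC (β x γ)))
    have hsmall : C * tvDist ξ ξ' ≤ r / 2 := by
      calc C * tvDist ξ ξ' ≤ (C + 1) * (r / (2 * (C + 1))) := by
            exact mul_le_mul (by linarith) hclose tvDist_nonneg (by positivity)
        _ = r / 2 := by field_simp
    refine (abs_sub_le _ (∫ x, (L (β x γ)).real F * G (β x γ) ∂ξ) _).trans ?_
    linarith [hγ F hF, h.trans hsmall]
  have mass_close : |Z - ∫ x, G (β x γ) ∂ξ'| ≤ r := by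
    simpa using numerator_close Set.univ MeasurableSet.univ
  have hpos' : 0 < ∫ x, G (β x γ) ∂ξ' := by linarith [(abs_le.1 mass_close).2]
  have hprob := isProbabilityMeasure_update (ξ := ξ) hG.measurable hG0 hL hLprob hpos
  have hprob' := isProbabilityMeasure_update (ξ := ξ') hG' (fun x => hG0 (β x γ)) hL'
    (fun x => hLprob (β x γ)) hpos'
  refine ⟨hprob', (tvDist_le (by positivity) fun F hF => ?_).trans hrε⟩
  rw [update_real hG.measurable hG0 hL hLprob hF,
    update_real hG' (fun x => hG0 (β x γ)) hL' (fun x => hLprob (β x γ)) hF]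
  refine abs_div_sub_div_le hpos hpos'
    (integral_nonneg fun x => mul_nonneg measureReal_nonneg (hG0 (β x γ)))
    (integral_mono_of_nonneg
      (.of_forall fun x => mul_nonneg measureReal_nonneg (hG0 (β x γ)))
      (Integrable.of_mem_Icc 0 C hG'.aemeasurable
        (.of_forall fun x => ⟨hG0 (β x γ), hGC (β x γ)⟩))
      (.of_forall fun x => mul_le_of_le_one_left (hG0 (β x γ)) measureReal_le_one))
    (numerator_close F hF) mass_close

end Perturbation

section Model

variable {π0 : Measure X} {K : ℕ → X → Measure X} {g : ℕ → X → ℝ}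

lemma filt_alt_congr {a a' : ℕ → X → X} {n : ℕ} (h : ∀ j ≤ n, a j = a' j) :
    filt π0 (altKernel K a) (altG g a) n = filt π0 (altKernel K a') (altG g a') n := by
  induction n with
  | zero => rfl
  | succ n ih =>
    have hK : altKernel K a (n + 1) = altKernel K a' (n + 1) := by
      funext x
      simp [altKernel, h n n.le_succ]
    have hg : altG g a (n + 1) = altG g a' (n + 1) := by
      funext x
      simp only [altG, h (n + 1) le_rfl]
    simp only [filt, ih fun j hj => h j (hj.trans n.le_succ), hK, hg]

lemma pred_alt_congr {a a' : ℕ → X → X} {n : ℕ} (h : ∀ j ≤ n, a j = a' j) :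
    pred π0 (altKernel K a) (altG g a) (n + 1) = pred π0 (altKernel K a') (altG g a') (n + 1) := by
  have hK : altKernel K a (n + 1) = altKernel K a' (n + 1) := by
    funext x
    simp [altKernel, h n le_rfl]
  simp only [pred, Nat.add_sub_cancel, filt_alt_congr h, hK]

lemma aOf_congr {Y : Type*} {α : ℕ → Y → ℝ → Y} {γ γ' : ℕ → ℝ} {j : ℕ} (h : γ j = γ' j) :
    aOf α γ j = aOf α γ' j := by
  funext x
  simp only [aOf, h]

lemma pred_alt_one (α : ℕ → X → ℝ → X) (γ : ℕ → ℝ) :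
    pred π0 (altKernel K (aOf α γ)) (altG g (aOf α γ)) 1 = pred π0 K g 1 := by
  have hK : altKernel K (aOf α γ) 1 = K 1 := by
    funext x
    simp [altKernel, aOf]
  simp [pred, filt, hK]

lemma pred_alt_add_two (α : ℕ → X → ℝ → X) (γ : ℕ → ℝ) (t : ℕ) :
    pred π0 (altKernel K (aOf α γ)) (altG g (aOf α γ)) (t + 2) =
      update (pred π0 (altKernel K (aOf α γ)) (altG g (aOf α γ)) (t + 1))
        (fun x => g (t + 1) (α (t + 1) x (γ (t + 1))))
        (fun x => K (t + 2) (α (t + 1) x (γ (t + 1)))) := by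
  rw [pred_add_two]
  congr 1

/-- If no predictive measure vanishes, then every predictive measure is a probability measure and
gives its likelihood positive mass. -/
lemma isProbabilityMeasure_pred (hπ0 : IsProbabilityMeasure π0) (hKmeas : ∀ t, Measurable (K t))
    (hKprob : ∀ t x, IsProbabilityMeasure (K t x)) (hg : ∀ t, Measurable (g t))
    (hg0 : ∀ t x, 0 ≤ g t x) (hgbdd : ∀ t, ∃ C : ℝ, ∀ x, g t x ≤ C)
    (hne : ∀ t, pred π0 K g t ≠ 0) (t : ℕ) :
    IsProbabilityMeasure (pred π0 K g (t + 1)) ∧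
      0 < ∫ x, g (t + 1) x ∂(pred π0 K g (t + 1)) := by
  have mass_pos {t : ℕ} (_ : IsProbabilityMeasure (pred π0 K g (t + 1))) :
      0 < ∫ x, g (t + 1) x ∂(pred π0 K g (t + 1)) := by
    obtain ⟨C, hC⟩ := hgbdd (t + 1)
    refine (integral_nonneg (hg0 (t + 1))).lt_of_ne' fun hzero => hne (t + 2) ?_
    rw [pred_add_two, update_eq_zero_of_integral_eq_zero (hg (t + 1)) (hg0 (t + 1)) hC hzero]
  induction t with
  | zero =>
    have hprob : IsProbabilityMeasure (π0.bind (K 1)) :=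
      isProbabilityMeasure_bind (hKmeas 1).aemeasurable (.of_forall (hKprob 1))
    exact ⟨hprob, mass_pos hprob⟩
  | succ t ih =>
    have hprob : IsProbabilityMeasure (pred π0 K g (t + 2)) := by
      rw [pred_add_two]
      exact isProbabilityMeasure_update (hg _) (hg0 _) (hKmeas _) (hKprob _) ih.2
    exact ⟨hprob, mass_pos hprob⟩

end Model

/-- **Lemma (inductive choice of the nudging parameters).**
Under Assumption A2, for parametric nudging transformations `{α_t}`, for every finite
`t ∈ ℕ` and `ε > 0` there are positive parameters `γ_1(ε), …, γ_t(ε)` such that the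
alternative nudged model built with these parameters satisfies
`Δ_{g_i}(γ_i) ≥ ‖g_i‖_∞ ‖ξ_i - ξ̄_i^α‖_TV` for `i = 1, …, t` and
`‖ξ_{t+1} - ξ̄_{t+1}^α‖_TV ≤ ε`. -/
theorem inductive_parameter_choice
    {d : ℕ}
    (π0 : Measure (EuclideanSpace ℝ (Fin d))) (hπ0 : IsProbabilityMeasure π0)
    (K : ℕ → EuclideanSpace ℝ (Fin d) → Measure (EuclideanSpace ℝ (Fin d)))
    (hKmeas : ∀ t', Measurable (K t'))
    (hKprob : ∀ t' x, IsProbabilityMeasure (K t' x))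
    (g : ℕ → EuclideanSpace ℝ (Fin d) → ℝ)
    (hg0 : ∀ t' x, 0 ≤ g t' x)
    -- Assumption A2 (i): the likelihoods are continuous and bounded
    (hgcont : ∀ t', Continuous (g t'))
    (hgbdd : ∀ t', ∃ C : ℝ, ∀ x, g t' x ≤ C)
    -- Assumption A2 (ii): the kernels are continuous in total variation
    (hKtv : ∀ t' (x : EuclideanSpace ℝ (Fin d)), ∀ ε' > (0 : ℝ), ∃ δ > (0 : ℝ),
        ∀ x', ‖x - x'‖ ≤ δ → tvDist (K t' x) (K t' x') ≤ ε')
    -- `{α_t}` is a family of parametric nudging transformations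
    (α : ℕ → EuclideanSpace ℝ (Fin d) → ℝ → EuclideanSpace ℝ (Fin d))
    (hαmeas : ∀ t' γ', Measurable fun x => α t' x γ')
    (hαcont : ∀ t' x, ContinuousOn (fun γ' => α t' x γ') (Set.Ici 0))
    (hα0 : ∀ t' x, α t' x 0 = x)
    (Γ : ℕ → ℝ) (hΓ : ∀ t', 0 < Γ t')
    (hinc : ∀ t' x, ∀ γ' ∈ Set.Icc (0 : ℝ) (Γ t'), g t' x ≤ g t' (α t' x γ'))
    (hΔpos : ∀ t', ∀ γ' ∈ Set.Ioc (0 : ℝ) (Γ t'),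
        0 < ∫ x, (g t' (α t' x γ') - g t' x) ∂(pred π0 K g t'))
    (t : ℕ) (ε : ℝ) (hε : 0 < ε) :
    ∃ γseq : ℕ → ℝ,
      (∀ i, 1 ≤ i → i ≤ t → 0 < γseq i) ∧
      (∀ i, 1 ≤ i → i ≤ t →
        supNorm (g i) *
            tvDist (pred π0 K g i)
              (pred π0 (altKernel K (aOf α γseq)) (altG g (aOf α γseq)) i) ≤
          ∫ x, (g i (α i x (γseq i)) - g i x) ∂(pred π0 K g i)) ∧
      tvDist (pred π0 K g (t + 1))
          (pred π0 (altKernel K (aOf α γseq)) (altG g (aOf α γseq)) (t + 1)) ≤ ε := by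
  have hne (s : ℕ) : pred π0 K g s ≠ 0 := by
    intro hzero
    have hpos := hΔpos s (Γ s) ⟨hΓ s, le_rfl⟩
    rw [hzero, integral_zero_measure] at hpos
    exact hpos.false
  have hpred := isProbabilityMeasure_pred hπ0 hKmeas hKprob (fun s => (hgcont s).measurable)
    hg0 hgbdd hne
  have hαlim (s : ℕ) (x : EuclideanSpace ℝ (Fin d)) :
      Filter.Tendsto (α s x) (nhdsWithin 0 (Set.Ioi 0)) (nhds x) := by
    have h := (hαcont s x 0 Set.self_mem_Ici).mono_left
      (nhdsWithin_mono 0 Set.Ioi_subset_Ici_self)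
    simpa only [hα0 s x] using h
  -- The induction also carries that the nudged predictive measure is a probability measure.
  suffices h : ∃ γseq : ℕ → ℝ,
      ((∀ i, 1 ≤ i → i ≤ t → 0 < γseq i) ∧
      (∀ i, 1 ≤ i → i ≤ t →
        supNorm (g i) *
            tvDist (pred π0 K g i)
              (pred π0 (altKernel K (aOf α γseq)) (altG g (aOf α γseq)) i) ≤
          ∫ x, (g i (α i x (γseq i)) - g i x) ∂(pred π0 K g i)) ∧
      tvDist (pred π0 K g (t + 1))
          (pred π0 (altKernel K (aOf α γseq)) (altG g (aOf α γseq)) (t + 1)) ≤ ε) ∧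
      IsProbabilityMeasure
        (pred π0 (altKernel K (aOf α γseq)) (altG g (aOf α γseq)) (t + 1)) from
    h.imp fun _ => And.left
  induction t generalizing ε with
  | zero =>
    refine ⟨fun _ => 1, ⟨fun i h1 h0 => by omega, fun i h1 h0 => by omega, ?_⟩, ?_⟩
    · rw [pred_alt_one, tvDist_self]
      exact hε.le
    · rw [pred_alt_one]
      exact (hpred 0).1
  | succ t ih =>
    obtain ⟨hprob, hpos⟩ := hpred t
    obtain ⟨C, hC⟩ := hgbdd (t + 1)
    obtain ⟨η, hη, hevent⟩ := eventually_update_nudged_close (ξ := pred π0 K g (t + 1))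
      (hgcont (t + 1)) (hg0 (t + 1)) hC hpos (hKmeas (t + 2)) (hKprob (t + 2)) (hKtv (t + 2))
      (hαmeas (t + 1)) (hαlim (t + 1)) hε
    obtain ⟨γ, hstep, hγ⟩ := (hevent.and (Ioc_mem_nhdsGT (hΓ (t + 1)))).exists
    have hΔ := hΔpos (t + 1) γ hγ
    set Δ := ∫ x, (g (t + 1) (α (t + 1) x γ) - g (t + 1) x) ∂(pred π0 K g (t + 1))
    have hnorm : 0 ≤ supNorm (g (t + 1)) := Real.iSup_nonneg fun x => abs_nonneg _
    obtain ⟨γs, ⟨hγpos, hγΔ, hγtv⟩, hγprob⟩ :=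
      ih (min η (Δ / (supNorm (g (t + 1)) + 1))) (by positivity)
    have hold (j : ℕ) (hj : j ≤ t) : Function.update γs (t + 1) γ j = γs j :=
      Function.update_of_ne (by omega) _ _
    have hnew : Function.update γs (t + 1) γ (t + 1) = γ := Function.update_self _ _ _
    have hcongr (n : ℕ) (hn : n ≤ t) :=
      pred_alt_congr (π0 := π0) (K := K) (g := g) (n := n)
        fun j hj => aOf_congr (α := α) (hold j (hj.trans hn))
    have hclose := hstep _ hγprob (hγtv.trans (min_le_left _ _))
    refine ⟨Function.update γs (t + 1) γ, ⟨fun i h1 hi => ?_, fun i h1 hi => ?_, ?_⟩, ?_⟩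
    · rcases Nat.le_succ_iff.1 hi with hi | rfl
      · rw [hold i hi]
        exact hγpos i h1 hi
      · rw [hnew]
        exact hγ.1
    · rcases Nat.le_succ_iff.1 hi with hi | rfl
      · obtain ⟨n, rfl⟩ := Nat.exists_eq_add_of_le' h1
        rw [hcongr n (by omega), hold _ hi]
        exact hγΔ _ h1 hi
      · rw [hcongr t le_rfl, hnew]
        calc _ ≤ (supNorm (g (t + 1)) + 1) * (Δ / (supNorm (g (t + 1)) + 1)) :=
              mul_le_mul (by linarith) (hγtv.trans (min_le_right _ _)) tvDist_nonneg
                (by positivity)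
          _ = Δ := by field_simp
    · rw [pred_alt_add_two, hcongr t le_rfl, hnew]
      exact hclose.2
    · rw [pred_alt_add_two, hcongr t le_rfl, hnew]
      exact hclose.1

end Nudging
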